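/- Let H be a near-triangulation whose outer face is bounded by a 4-cycle R = v₁v₂v₃v₄, and let a proper 4-coloring of H be given. Then, by performing a single Kempe change in H, one can produce a second 4-coloring of H and a value j ∈ {1, 2} such that either (i) the given coloring and the new coloring restrict to R as both 4-colorings (up to permutation of colors) of R in which v_j and v_{j+2} receive different colors, or (ii) they restrict to R as both 4-colorings of R in which v_j and v_{j+2} receive the same color; moreover, this can be done in time linear in the size of H. -/

import Mathlib

/-!
Common formal framework for statements from
"A near-linear time 4-coloring algorithm for planar graphs".

Plane embeddings are modelled combinatorially by rotation systems on darts
(Heffter–Edmonds): a graph together with a rotation system embeds in the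
orientable surface whose faces are the orbits of the face-tracing permutation,
and the embedding is in the 2-sphere precisely when Euler's relation holds.
-/

namespace FourColor

open SimpleGraph

/-- Degree of a vertex, as the cardinality of its neighbour set. -/
noncomputable def vdeg {V : Type} (G : SimpleGraph V) (v : V) : ℕ :=
  (G.neighborSet v).ncard

/-- Dart reversal, as a permutation of the darts of a graph. -/
def dartRev {V : Type} (G : SimpleGraph V) : Equiv.Perm G.Dart where
  toFun := SimpleGraph.Dart.symm
  invFun := SimpleGraph.Dart.symm
  left_inv d := SimpleGraph.Dart.symm_symm d
  right_inv d := SimpleGraph.Dart.symm_symm d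

/-- A combinatorial embedding (rotation system) of a graph: a permutation of the
darts fixing tails, whose restriction to the darts out of each vertex is a
single cycle (the clockwise rotation around the vertex). -/
structure CombEmbedding {V : Type} (G : SimpleGraph V) where
  rot : Equiv.Perm G.Dart
  rot_fst : ∀ d : G.Dart, (rot d).toProd.1 = d.toProd.1
  rot_cyclic : ∀ d d' : G.Dart, d.toProd.1 = d'.toProd.1 → ∃ n : ℕ, (rot ^ n) d = d'

namespace CombEmbedding

variable {V : Type} {G : SimpleGraph V}

/-- The face-tracing permutation of an embedding. -/
def facePerm (E : CombEmbedding G) : Equiv.Perm G.Dart :=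
  (dartRev G).trans E.rot

/-- Two darts lie on the same face iff they are in the same orbit of the
face-tracing permutation. -/
def faceSetoid (E : CombEmbedding G) : Setoid G.Dart where
  r d d' := ∃ n : ℤ, (E.facePerm ^ n) d = d'
  iseqv := by
    refine ⟨fun d => ⟨0, by simp⟩, ?_, ?_⟩
    · rintro d d' ⟨n, h⟩
      refine ⟨-n, ?_⟩
      rw [← h, ← Equiv.Perm.mul_apply, ← zpow_add, neg_add_cancel, zpow_zero,
        Equiv.Perm.one_apply]
    · rintro a b c ⟨m, h1⟩ ⟨n, h2⟩
      refine ⟨n + m, ?_⟩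
      rw [← h2, ← h1, ← Equiv.Perm.mul_apply, ← zpow_add]

/-- The number of faces of an embedding. -/
noncomputable def numFaces (E : CombEmbedding G) : ℕ :=
  Nat.card (Quotient E.faceSetoid)

/-- Euler's relation characterising embeddings of a (possibly disconnected)
finite graph in the 2-sphere: `V - E + F = 2·(#components) - (#isolated vertices)`. -/
def IsSpherical [Fintype V] (E : CombEmbedding G) : Prop :=
  (Fintype.card V : ℤ) - (G.edgeSet.ncard : ℤ) + (E.numFaces : ℤ) =
    2 * (Nat.card G.ConnectedComponent : ℤ) - (({v : V | ∀ w, ¬ G.Adj v w}).ncard : ℤ)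

end CombEmbedding

/-- A finite simple graph is planar iff it admits a rotation system
satisfying Euler's relation for the sphere. -/
def IsPlanar {V : Type} [Fintype V] (G : SimpleGraph V) : Prop :=
  ∃ E : CombEmbedding G, E.IsSpherical

/-- A planar triangulation: a connected simple graph embedded in the 2-sphere
(Euler's relation) all of whose faces are triangles. -/
structure PlaneTriangulation (V : Type) [Fintype V] where
  graph : SimpleGraph V
  emb : CombEmbedding graph
  conn : graph.Connected
  euler : (Fintype.card V : ℤ) - (graph.edgeSet.ncard : ℤ) + (emb.numFaces : ℤ) = 2
  faces_tri : ∀ d : graph.Dart, (emb.facePerm ^ 3) d = d ∧ emb.facePerm d ≠ d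

/-- A near-triangulation: a connected plane graph, with a designated outer face,
all of whose faces except the outer one are triangles.  (The trivial
near-triangulations on a single vertex are allowed.) -/
structure NearTriangulation (V : Type) [Fintype V] where
  graph : SimpleGraph V
  emb : CombEmbedding graph
  conn : graph.Connected
  euler : Fintype.card V = 1 ∨
    (Fintype.card V : ℤ) - (graph.edgeSet.ncard : ℤ) + (emb.numFaces : ℤ) = 2
  /-- membership of a dart in the (boundary walk of the) outer face -/
  isOuter : graph.Dart → Prop
  outer_closed : ∀ d, isOuter d → isOuter (emb.facePerm d)
  outer_single : ∀ d d', isOuter d → isOuter d' → ∃ n : ℕ, (emb.facePerm ^ n) d = d'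
  outer_nonempty : ∀ _ : graph.Dart, ∃ d', isOuter d'
  inner_tri : ∀ d, ¬ isOuter d → (emb.facePerm ^ 3) d = d ∧ emb.facePerm d ≠ d

namespace NearTriangulation

variable {V : Type} [Fintype V]

/-- A vertex lies on the outer face boundary. -/
def OnOuter (N : NearTriangulation V) (v : V) : Prop :=
  IsEmpty N.graph.Dart ∨ ∃ d : N.graph.Dart, N.isOuter d ∧ d.toProd.1 = v

/-- An edge lies on the outer face boundary. -/
def IsOuterEdge (N : NearTriangulation V) (x y : V) : Prop :=
  ∃ d : N.graph.Dart, N.isOuter d ∧ (d.toProd = (x, y) ∨ d.toProd = (y, x))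

end NearTriangulation

/-- `v` is a cut-vertex of `G`: deleting it increases the number of
connected components. -/
def IsCutVertex {V : Type} (G : SimpleGraph V) (v : V) : Prop :=
  Nat.card G.ConnectedComponent <
    Nat.card (G.induce {w : V | w ≠ v}).ConnectedComponent

/-- A configuration `(Z, δ)`: a near-triangulation together with a degree
function which agrees with the degree at interior vertices, exceeds it at
outer vertices, and with at most one cut-vertex, lying in exactly two blocks
and having external degree 2. -/
structure Configuration (V : Type) [Fintype V] extends NearTriangulation V where
  δ : V → ℕ
  delta_inner : ∀ v : V, ¬ toNearTriangulation.OnOuter v → δ v = vdeg graph v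
  delta_outer : ∀ v : V, toNearTriangulation.OnOuter v → vdeg graph v < δ v
  cut_unique : ∀ u w : V, IsCutVertex graph u → IsCutVertex graph w → u = w
  cut_cond : ∀ v : V, IsCutVertex graph v →
    Nat.card (graph.induce {w : V | w ≠ v}).ConnectedComponent = 2 ∧
    δ v = vdeg graph v + 2

/-- The map induced on darts by an adjacency-preserving vertex map. -/
def dartMap {A V : Type} {ZG : SimpleGraph A} {G : SimpleGraph V} (f : A → V)
    (h : ∀ ⦃a b : A⦄, ZG.Adj a b → G.Adj (f a) (f b)) (d : ZG.Dart) : G.Dart :=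
  ⟨(f d.toProd.1, f d.toProd.2), h d.adj⟩

/-- An orientation-preserving homomorphism of a configuration into a plane
triangulation: adjacency-preserving, sending inner facial triangles to facial
triangles with the same orientation, and matching the prescribed degrees. -/
def IsConfigHomMap {A V : Type} [Fintype A] [Fintype V] (C : Configuration A)
    (T : PlaneTriangulation V) (f : A → V) : Prop :=
  ∃ h : ∀ ⦃a b : A⦄, C.graph.Adj a b → T.graph.Adj (f a) (f b),
    (∀ v : A, vdeg T.graph (f v) = C.δ v) ∧
    (∀ d : C.graph.Dart, ¬ C.isOuter d →
      T.emb.facePerm (dartMap f h d) = dartMap f h (C.emb.facePerm d))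

/-- `f` exhibits the configuration `C` as being contained in the plane
triangulation `T`: an injective orientation-preserving homomorphism matching
degrees; moreover at a cut-vertex the two incident edges of `T` not coming
from `C` are non-consecutive in the rotation. -/
def IsContainMap {A V : Type} [Fintype A] [Fintype V] (C : Configuration A)
    (T : PlaneTriangulation V) (f : A → V) : Prop :=
  Function.Injective f ∧ IsConfigHomMap C T f ∧
  ∀ v : A, IsCutVertex C.graph v →
    ∀ e e' : T.graph.Dart, e.toProd.1 = f v → e'.toProd.1 = f v →
      (¬ ∃ a b : A, C.graph.Adj a b ∧ e.toProd = (f a, f b)) →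
      (¬ ∃ a b : A, C.graph.Adj a b ∧ e'.toProd = (f a, f b)) →
      e ≠ e' → T.emb.rot e ≠ e'

/-- A configuration on a concrete finite vertex set. -/
def ConfigOn : Type := Σ n : ℕ, Configuration (Fin n)

/-- The configuration `C` is contained in `T` within the set `S` of vertices. -/
def ConfigOn.ContainedIn (C : ConfigOn) {V : Type} [Fintype V]
    (T : PlaneTriangulation V) (S : Set V) : Prop :=
  ∃ f : Fin C.1 → V, IsContainMap C.2 T f ∧ Set.range f ⊆ S

/-- The configuration `C` is induced in `T` within the set `S` of vertices. -/
def ConfigOn.InducedIn (C : ConfigOn) {V : Type} [Fintype V]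
    (T : PlaneTriangulation V) (S : Set V) : Prop :=
  ∃ f : Fin C.1 → V, IsContainMap C.2 T f ∧ Set.range f ⊆ S ∧
    ∀ a b : Fin C.1, T.graph.Adj (f a) (f b) → C.2.graph.Adj a b

/-- Paper condition (ii) of Lemma `induced-config`: any two vertices at
distance exactly 4 are joined by a length-4 path which either is not contained
in the outer face boundary, or contains an internal vertex which is not a
cut-vertex and has external degree at least 2. -/
def SecondNbrCond {A : Type} [Fintype A] (C : Configuration A) : Prop :=
  ∀ u w : A, C.graph.dist u w = 4 →
    ∃ p : C.graph.Walk u w, p.IsPath ∧ p.length = 4 ∧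
      ((¬ ∀ d ∈ p.darts, C.toNearTriangulation.IsOuterEdge d.toProd.1 d.toProd.2) ∨
        ∃ x ∈ p.support, x ≠ u ∧ x ≠ w ∧ ¬ IsCutVertex C.graph x ∧
          vdeg C.graph x + 2 ≤ C.δ x)

/-! ### Balls and obstructing cycles -/

/-- The set of vertices at distance at most `k` from `v` (vertex set of `B_k(v)`). -/
def ballSet {V : Type} (G : SimpleGraph V) (v : V) (k : ℕ) : Set V :=
  {u | ∃ p : G.Walk v u, p.length ≤ k}

/-- Vertex set of the degree-bounded ball `B^8_k(v)`. -/
def dBallSet {V : Type} (G : SimpleGraph V) (v : V) (k : ℕ) : Set V :=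
  {u | ∃ p : G.Walk v u, p.length ≤ k ∧ ∀ x ∈ p.support, x = v ∨ vdeg G x ≤ 8}

/-- Vertex set of the extended degree-bounded ball `B̄^8_k(v)`. -/
def extdBallSet {V : Type} (G : SimpleGraph V) (v : V) (k : ℕ) : Set V :=
  dBallSet G v k ∪
    {u | 9 ≤ vdeg G u ∧ ∃ p : G.Walk v u, p.length ≤ k ∧
      ∀ x ∈ p.support, x = v ∨ x = u ∨ vdeg G x ≤ 8}

/-- An obstructing cycle: a cycle of length at most 4 with at least one vertex
on each of its two sides, or of length 5 with at least two vertices on each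
side.  (The two sides of a cycle of a plane triangulation are unions of
components of the complement, with no edges from one side to the other.) -/
def IsObstructingCycle {V : Type} {G : SimpleGraph V} {x : V} (c : G.Walk x x) : Prop :=
  c.IsCycle ∧
  ∃ A B : Set V,
    (∀ v : V, v ∉ c.support → v ∈ A ∨ v ∈ B) ∧
    (∀ v ∈ A, v ∉ c.support) ∧ (∀ v ∈ B, v ∉ c.support) ∧
    Disjoint A B ∧
    (∀ a ∈ A, ∀ b ∈ B, ¬ G.Adj a b) ∧
    ((c.length ≤ 4 ∧ A.Nonempty ∧ B.Nonempty) ∨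
      (c.length = 5 ∧ 2 ≤ A.ncard ∧ 2 ≤ B.ncard))

/-- `G` has an obstructing cycle all of whose vertices lie in `S`. -/
def HasObstructingCycleIn {V : Type} (G : SimpleGraph V) (S : Set V) : Prop :=
  ∃ (x : V) (c : G.Walk x x), IsObstructingCycle c ∧ ∀ y ∈ c.support, y ∈ S

/-- A chordless cycle: every edge of `G` between vertices of the cycle is an
edge of the cycle. -/
def IsChordless {V : Type} {G : SimpleGraph V} {x : V} (c : G.Walk x x) : Prop :=
  ∀ u v : V, u ∈ c.support → v ∈ c.support → G.Adj u v → s(u, v) ∈ c.edges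

/-- Two vertex sets touch: they share a vertex, or an edge of `G` joins them. -/
def Touches {V : Type} (G : SimpleGraph V) (S S' : Set V) : Prop :=
  (S ∩ S').Nonempty ∨ ∃ s ∈ S, ∃ t ∈ S', G.Adj s t

/-- A `k`-local obstructing cycle around `v`, with designated public part
`pub`: the cycle lies in `B̄^8_k(v)`, the public part consists of at most two
vertices which are consecutive on the cycle, and everything outside the public
part (the private part) lies in `B^8_k(v)`. -/
def IsLocalObstructing {V : Type} (G : SimpleGraph V) (v : V) (k : ℕ) {x : V}
    (c : G.Walk x x) (pub : Set V) : Prop :=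
  IsObstructingCycle c ∧
  (∀ y ∈ c.support, y ∈ extdBallSet G v k) ∧
  pub ⊆ {y | y ∈ c.support} ∧
  pub.ncard ≤ 2 ∧
  (∀ y ∈ pub, ∀ z ∈ pub, y ≠ z → s(y, z) ∈ c.edges) ∧
  (∀ y ∈ c.support, y ∉ pub → y ∈ dBallSet G v k)

/-! ### Discharging and charges -/

/-- Initial charge `T₀(v) = 10·(6 − d(v))`. -/
noncomputable def initialCharge {V : Type} (G : SimpleGraph V) (v : V) : ℤ :=
  10 * (6 - (vdeg G v : ℤ))

/-- Final charge of `v`, given the function `send u v` recording the total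
charge sent from `u` to `v` by the discharging rules (`send u v = 0` for
non-adjacent `u, v`). -/
noncomputable def finalCharge {V : Type} [Fintype V] (G : SimpleGraph V)
    (send : V → V → ℤ) (v : V) : ℤ :=
  initialCharge G v + ∑ u : V, (send u v - send v u)

/-- A discharging assignment: for every plane triangulation, an amount of
charge sent along each ordered pair of vertices, nonnegative and vanishing on
non-adjacent pairs.  (The paper's fixed set `ℛ` of 43 discharging rules
determines such an assignment.) -/
def IsDischargeAssignment
    (Φ : ∀ (V : Type) [Fintype V], PlaneTriangulation V → V → V → ℤ) : Prop :=
  ∀ (V : Type) [Fintype V] (T : PlaneTriangulation V) (u v : V),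
    (¬ T.graph.Adj u v → Φ V T u v = 0) ∧ 0 ≤ Φ V T u v

/-! ### Colorings and Kempe changes -/

/-- A proper 4-coloring. -/
def IsProperColoring {U : Type} (G : SimpleGraph U) (c : U → Fin 4) : Prop :=
  ∀ ⦃u v : U⦄, G.Adj u v → c u ≠ c v

/-- `u` and `w` lie in a common `ab`-Kempe chain inside `S`. -/
def KempeConnOn {U : Type} (G : SimpleGraph U) (S : Set U) (c : U → Fin 4)
    (a b : Fin 4) (u w : U) : Prop :=
  ∃ p : G.Walk u w, ∀ x ∈ p.support, x ∈ S ∧ (c x = a ∨ c x = b)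

/-- A Kempe change (within the vertex set `S`): for complementary color pairs
`{a,b}` and `{e,f}`, swap the two colors on some `ab`-Kempe chains and some
`ef`-Kempe chains. -/
def IsKempeChangeOn {U : Type} (G : SimpleGraph U) (S : Set U)
    (c c' : U → Fin 4) : Prop :=
  (∀ v ∉ S, c' v = c v) ∧
  ∃ a b e f : Fin 4, ({a, b, e, f} : Set (Fin 4)) = Set.univ ∧
    (∀ v ∈ S, c' v = c v ∨ (c v = a ∧ c' v = b) ∨ (c v = b ∧ c' v = a) ∨
      (c v = e ∧ c' v = f) ∨ (c v = f ∧ c' v = e)) ∧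
    (∀ u w : U, (KempeConnOn G S c a b u w ∨ KempeConnOn G S c e f u w) →
      ((c' u = c u) ↔ (c' w = c w)))

/-- A Kempe change. -/
def IsKempeChange {U : Type} (G : SimpleGraph U) (c c' : U → Fin 4) : Prop :=
  IsKempeChangeOn G Set.univ c c'

/-- A single Kempe change: swap two colors on one Kempe chain. -/
def IsSingleKempeChange {U : Type} (G : SimpleGraph U) (c c' : U → Fin 4) : Prop :=
  ∃ a b : Fin 4, a ≠ b ∧ ∃ u₀ : U, (c u₀ = a ∨ c u₀ = b) ∧
    ∀ v : U,
      (KempeConnOn G Set.univ c a b u₀ v →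
        ((c v = a ∧ c' v = b) ∨ (c v = b ∧ c' v = a))) ∧
      (¬ KempeConnOn G Set.univ c a b u₀ v → c' v = c v)

/-- Two colorings agree up to a permutation of the colors. -/
def ColorPermEq {α : Type} (κ κ' : α → Fin 4) : Prop :=
  ∃ σ : Equiv.Perm (Fin 4), ∀ x : α, κ' x = σ (κ x)

/-! ### Free completions, rings, reducibility -/

/-- A free completion of the configuration `C`, with ring vertex set `W`:
a near-triangulation on `A ⊕ W` whose outer face is the ring cycle on `W`
(disjoint from `C`), containing `C` with the prescribed degrees and inner
faces. -/
structure FreeCompletion {A : Type} [Fintype A] (C : Configuration A)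
    (W : Type) [Fintype W] where
  nt : NearTriangulation (A ⊕ W)
  ring_outer : ∀ x : A ⊕ W, nt.OnOuter x ↔ ∃ w : W, x = Sum.inr w
  outer_simple : ∀ d d' : nt.graph.Dart, nt.isOuter d → nt.isOuter d' →
    d.toProd.1 = d'.toProd.1 → d = d'
  adj_iff : ∀ a b : A, nt.graph.Adj (Sum.inl a) (Sum.inl b) ↔ C.graph.Adj a b
  deg_eq : ∀ a : A, vdeg nt.graph (Sum.inl a) = C.δ a
  faces_comm : ∀ d : C.graph.Dart, ¬ C.isOuter d →
    nt.emb.facePerm (dartMap Sum.inl (fun a b hab => (adj_iff a b).mpr hab) d) =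
      dartMap Sum.inl (fun a b hab => (adj_iff a b).mpr hab) (C.emb.facePerm d)
  ring_edges_outer : ∀ w w' : W, nt.graph.Adj (Sum.inr w) (Sum.inr w') →
    ∃ d : nt.graph.Dart, nt.isOuter d ∧
      ((d.toProd.1 = Sum.inr w ∧ d.toProd.2 = Sum.inr w') ∨
       (d.toProd.1 = Sum.inr w' ∧ d.toProd.2 = Sum.inr w))

namespace FreeCompletion

variable {A W : Type} [Fintype A] [Fintype W] {C : Configuration A}

/-- Adjacency on the ring. -/
def RingAdj (FC : FreeCompletion C W) (w w' : W) : Prop :=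
  FC.nt.graph.Adj (Sum.inr w) (Sum.inr w')

/-- A proper 4-coloring of the ring. -/
def RingProper (FC : FreeCompletion C W) (κ : W → Fin 4) : Prop :=
  ∀ w w' : W, FC.RingAdj w w' → κ w ≠ κ w'

end FreeCompletion

/-- `j` embeds a cycle into `G'` so that its image bounds a face of the
embedding `E'`. -/
def IsFacialEmbedding {W U : Type} {G' : SimpleGraph U} (E' : CombEmbedding G')
    (j : W → U) : Prop :=
  ∃ F : Set G'.Dart, F.Nonempty ∧ (∀ d ∈ F, E'.facePerm d ∈ F) ∧
    (∀ d ∈ F, ∀ d' ∈ F, ∃ n : ℕ, (E'.facePerm ^ n) d = d') ∧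
    (∀ w : W, ∃ d ∈ F, d.toProd.1 = j w) ∧
    (∀ d ∈ F, (∃ w : W, d.toProd.1 = j w) ∧ (∃ w : W, d.toProd.2 = j w))

/-- `i`-extendibility of a ring coloring `κ` (Birkhoff–Kempe reducibility):
`κ` is `0`-extendible if it extends to a proper 4-coloring of the free
completion; it is `(i+1)`-extendible if it is `i`-extendible or if, for every
plane graph `G'` containing the ring as a facial cycle and every proper
4-coloring of `G'` extending `κ`, some Kempe change yields a coloring whose
restriction to the ring is `i`-extendible. -/
def FreeCompletion.Extendible {A W : Type} [Fintype A] [Fintype W]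
    {C : Configuration A} (FC : FreeCompletion C W) :
    ℕ → (W → Fin 4) → Prop
  | 0, κ => ∃ c : A ⊕ W → Fin 4, IsProperColoring FC.nt.graph c ∧
      ∀ w : W, c (Sum.inr w) = κ w
  | (i + 1), κ => FreeCompletion.Extendible FC i κ ∨
      ∀ (U : Type) [Fintype U] (G' : SimpleGraph U) (E' : CombEmbedding G'),
        E'.IsSpherical →
        ∀ j : W → U, Function.Injective j →
          (∀ w w' : W, FC.RingAdj w w' ↔ G'.Adj (j w) (j w')) →
          IsFacialEmbedding E' j →
          ∀ c : U → Fin 4, IsProperColoring G' c → (∀ w : W, c (j w) = κ w) →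
            ∃ c' : U → Fin 4, IsProperColoring G' c' ∧ IsKempeChange G' c c' ∧
              FreeCompletion.Extendible FC i (fun w => c' (j w))

/-- The reducibility level of a ring coloring: the least `i` such that it is
`i`-extendible. -/
noncomputable def FreeCompletion.level {A W : Type} [Fintype A] [Fintype W]
    {C : Configuration A} (FC : FreeCompletion C W) (κ : W → Fin 4) : ℕ :=
  sInf {i : ℕ | FC.Extendible i κ}

/-- A configuration is D-reducible if, for some finite `i`, every proper
4-coloring of the ring of any free completion is `i`-extendible. -/
def DReducible {A : Type} [Fintype A] (C : Configuration A) : Prop :=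
  ∃ i : ℕ, ∀ (W : Type) [Fintype W] (FC : FreeCompletion C W) (κ : W → Fin 4),
    FC.RingProper κ → FC.Extendible i κ

/-- The defining properties of the paper's fixed set `𝒟` of 8202 D-reducible
configurations: each has at most 19 vertices, diameter at most 4, at most one
vertex of (prescribed) degree exceeding 8, ring size at most 18, and every
4-coloring of its ring is 25-extendible. -/
def DSetGood (𝓓 : Set ConfigOn) : Prop :=
  𝓓.ncard = 8202 ∧
  ∀ C ∈ 𝓓,
    C.1 ≤ 19 ∧
    (∀ a b : Fin C.1, C.2.graph.dist a b ≤ 4) ∧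
    ({v : Fin C.1 | 8 < C.2.δ v}).ncard ≤ 1 ∧
    ∃ (r : ℕ) (FC : FreeCompletion C.2 (Fin r)), r ≤ 18 ∧
      ∀ κ : Fin r → Fin 4, FC.RingProper κ → FC.Extendible 25 κ

end FourColor

namespace FourColor

namespace CombEmbedding

variable {V : Type} {G : SimpleGraph V} (E : CombEmbedding G)

lemma facePerm_apply (d : G.Dart) : E.facePerm d = E.rot d.symm := rfl

lemma facePerm_fst (d : G.Dart) : (E.facePerm d).toProd.1 = d.toProd.2 :=
  E.rot_fst d.symm

/-- The face whose boundary walk contains a dart. -/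
def face (d : G.Dart) : Quotient E.faceSetoid := Quotient.mk _ d

lemma face_facePerm (d : G.Dart) : E.face (E.facePerm d) = E.face d :=
  Quotient.sound (s := E.faceSetoid) ⟨-1, by simp⟩

lemma face_rot (d : G.Dart) : E.face (E.rot d) = E.face d.symm := by
  rw [← E.face_facePerm d.symm, facePerm_apply, SimpleGraph.Dart.symm_symm]

end CombEmbedding

section Homology

variable {V : Type} {G : SimpleGraph V}

/-- The edge underlying a dart, as an element of the edge set. -/
def dartEdge (d : G.Dart) : G.edgeSet := ⟨d.edge, d.edge_mem⟩

lemma dartEdge_symm (d : G.Dart) : dartEdge d.symm = dartEdge d :=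
  Subtype.ext d.edge_symm

lemma dartEdge_eq_iff (d d' : G.Dart) : dartEdge d = dartEdge d' ↔ d = d' ∨ d = d'.symm := by
  rw [← SimpleGraph.dart_edge_eq_iff, Subtype.ext_iff]; rfl

lemma exists_dartEdge_eq (e : G.edgeSet) : ∃ d : G.Dart, dartEdge d = e := by
  obtain ⟨e, he⟩ := e
  induction e with
  | _ u v => exact ⟨⟨(u, v), he⟩, rfl⟩

lemma pi_zmod_two_add_self {α : Type*} (g : α → ZMod 2) : g + g = 0 :=
  funext fun _ => CharTwo.add_self_eq_zero _

open Classical in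
/-- The mod 2 boundary map from edges to vertices. -/
noncomputable def edgeBoundary [Fintype G.Dart] :
    (G.edgeSet → ZMod 2) →ₗ[ZMod 2] (V → ZMod 2) where
  toFun z v := ∑ d : G.Dart with d.toProd.1 = v, z (dartEdge d)
  map_add' z z' := by ext v; simp [Finset.sum_add_distrib]
  map_smul' a z := by ext v; simp [Finset.mul_sum]

/-- The mod 2 boundary map from faces to edges. -/
noncomputable def faceBoundary (E : CombEmbedding G) :
    (Quotient E.faceSetoid → ZMod 2) →ₗ[ZMod 2] (G.edgeSet → ZMod 2) where
  toFun f e := f (E.face (exists_dartEdge_eq e).choose) +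
    f (E.face (exists_dartEdge_eq e).choose.symm)
  map_add' f f' := by ext e; simp only [Pi.add_apply]; ring
  map_smul' a f := by ext e; simp [mul_add]

lemma faceBoundary_apply (E : CombEmbedding G) (f : Quotient E.faceSetoid → ZMod 2)
    (d : G.Dart) : faceBoundary E f (dartEdge d) = f (E.face d) + f (E.face d.symm) := by
  change f (E.face (exists_dartEdge_eq (dartEdge d)).choose) +
    f (E.face (exists_dartEdge_eq (dartEdge d)).choose.symm) = _
  rcases (dartEdge_eq_iff _ _).1 (exists_dartEdge_eq (dartEdge d)).choose_spec with h | h <;>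
    rw [h]
  rw [SimpleGraph.Dart.symm_symm, add_comm]

lemma edgeBoundary_faceBoundary [Fintype G.Dart] (E : CombEmbedding G)
    (f : Quotient E.faceSetoid → ZMod 2) : edgeBoundary (faceBoundary E f) = 0 := by
  classical
  ext v
  change ∑ d : G.Dart with d.toProd.1 = v, faceBoundary E f (dartEdge d) = 0
  simp_rw [faceBoundary_apply, ← E.face_rot]
  rw [Finset.sum_add_distrib]
  have h : ∑ d : G.Dart with d.toProd.1 = v, f (E.face (E.rot d)) =
      ∑ d : G.Dart with d.toProd.1 = v, f (E.face d) := by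
    refine Finset.sum_equiv E.rot (fun d => ?_) (fun _ _ => rfl)
    simp [E.rot_fst]
  rw [h, CharTwo.add_self_eq_zero]

open Classical in
lemma edgeBoundary_single [Fintype G.Dart] (d : G.Dart) :
    edgeBoundary (Pi.single (dartEdge d) (1 : ZMod 2)) =
      Pi.single d.toProd.1 1 + Pi.single d.toProd.2 1 := by
  ext v
  change ∑ d' : G.Dart with d'.toProd.1 = v,
    (Pi.single (dartEdge d) (1 : ZMod 2) : G.edgeSet → ZMod 2) (dartEdge d') = _
  have h : ∀ d' : G.Dart, (Pi.single (dartEdge d) (1 : ZMod 2) : G.edgeSet → ZMod 2) (dartEdge d')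
      = (if d' = d then 1 else 0) + (if d' = d.symm then 1 else 0) := by
    intro d'
    have hne := d.symm_ne
    simp only [Pi.single_apply, dartEdge_eq_iff]
    by_cases h1 : d' = d <;> by_cases h2 : d' = d.symm <;> simp [h1, h2] <;> grind
  simp_rw [h]
  rw [Finset.sum_add_distrib]
  simp [Finset.sum_ite_eq', Pi.single_apply, eq_comm]

open Classical in
/-- The edges of a walk form a chain whose boundary consists of the two ends. -/
lemma exists_chain_of_walk [Fintype G.Dart] {u w : V} (p : G.Walk u w) :
    ∃ z : G.edgeSet → ZMod 2, edgeBoundary z = Pi.single u 1 + Pi.single w 1 ∧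
      ∀ d : G.Dart, d.toProd.1 ∉ p.support → z (dartEdge d) = 0 := by
  induction p with
  | nil => exact ⟨0, by rw [pi_zmod_two_add_self, map_zero], fun _ _ => rfl⟩
  | @cons u v w huv p ih =>
    obtain ⟨z, hz, hz0⟩ := ih
    let d : G.Dart := ⟨(u, v), huv⟩
    refine ⟨Pi.single (dartEdge d) 1 + z, ?_, fun d' hd' => ?_⟩
    · rw [map_add, edgeBoundary_single, hz]
      change Pi.single u 1 + Pi.single v 1 + (Pi.single v 1 + Pi.single w 1) = _
      rw [add_assoc, ← add_assoc (Pi.single v 1), pi_zmod_two_add_self, zero_add]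
    · rw [SimpleGraph.Walk.support_cons, List.mem_cons, not_or] at hd'
      rw [Pi.add_apply, hz0 d' hd'.2, add_zero, Pi.single_eq_of_ne]
      rw [Ne, dartEdge_eq_iff]
      rintro (rfl | rfl)
      · exact hd'.1 rfl
      · exact hd'.2 p.start_mem_support

/-- On a connected graph, a face function with zero boundary is constant. -/
lemma eq_of_faceBoundary_eq_zero (E : CombEmbedding G) (hG : G.Connected)
    {f : Quotient E.faceSetoid → ZMod 2} (hf : faceBoundary E f = 0) (d d' : G.Dart) :
    f (E.face d) = f (E.face d') := by
  have hsymm : ∀ d : G.Dart, f (E.face d) = f (E.face d.symm) := by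
    intro d
    rw [← CharTwo.add_eq_zero, ← faceBoundary_apply, hf]
    rfl
  have hrot : ∀ (n : ℕ) (d : G.Dart), f (E.face ((E.rot ^ n) d)) = f (E.face d) := by
    intro n d
    induction n with
    | zero => rfl
    | succ n ih => rw [pow_succ', Equiv.Perm.mul_apply, E.face_rot, ← hsymm, ih]
  have hstar : ∀ d d' : G.Dart, d.toProd.1 = d'.toProd.1 → f (E.face d) = f (E.face d') := by
    intro d d' h
    obtain ⟨n, rfl⟩ := E.rot_cyclic d d' h
    exact (hrot n d).symm
  have hwalk : ∀ (u w : V) (_ : G.Walk u w) (d d' : G.Dart), d.toProd.1 = u → d'.toProd.1 = w →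
      f (E.face d) = f (E.face d') := by
    intro u w p
    induction p with
    | nil => exact fun d d' h h' => hstar d d' (h.trans h'.symm)
    | @cons u v w huv p ih =>
      intro d d' h h'
      let a : G.Dart := ⟨(u, v), huv⟩
      rw [hstar d a h, hsymm a]
      exact ih a.symm d' rfl h'
  obtain ⟨p⟩ := hG d.toProd.1 d'.toProd.1
  exact hwalk _ _ p d d' rfl rfl

/-- On the sphere every mod 2 cycle bounds a set of faces. -/
lemma exists_faceBoundary_eq [Fintype V] [Fintype G.Dart] (E : CombEmbedding G)
    (hG : G.Connected)
    (hE : (Fintype.card V : ℤ) - (G.edgeSet.ncard : ℤ) + (E.numFaces : ℤ) = 2)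
    {z : G.edgeSet → ZMod 2} (hz : edgeBoundary z = 0) :
    ∃ f, faceBoundary E f = z := by
  classical
  have : Finite (Quotient E.faceSetoid) := inferInstance
  have := Fintype.ofFinite (Quotient E.faceSetoid)
  have hcardE : Fintype.card G.edgeSet = G.edgeSet.ncard := by
    rw [← Nat.card_eq_fintype_card]; rfl
  have hcardF : Fintype.card (Quotient E.faceSetoid) = E.numFaces := by
    rw [← Nat.card_eq_fintype_card]; rfl
  obtain ⟨v₀⟩ := hG.nonempty
  have hspan : LinearMap.range (edgeBoundary (G := G)) ⊔
      Submodule.span (ZMod 2) {(Pi.single v₀ 1 : V → ZMod 2)} = ⊤ := by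
    rw [eq_top_iff, ← (Pi.basisFun (ZMod 2) V).span_eq, Submodule.span_le]
    rintro _ ⟨v, rfl⟩
    obtain ⟨p⟩ := hG v v₀
    obtain ⟨y, hy, -⟩ := exists_chain_of_walk p
    rw [Pi.basisFun_apply, SetLike.mem_coe, Submodule.mem_sup]
    refine ⟨edgeBoundary y, ⟨y, rfl⟩, _, Submodule.mem_span_singleton_self _, ?_⟩
    rw [hy, add_assoc, pi_zmod_two_add_self, add_zero]
  have hrange : Fintype.card V ≤
      Module.finrank (ZMod 2) (LinearMap.range (edgeBoundary (G := G))) + 1 := by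
    have h1 := Submodule.finrank_add_le_finrank_add_finrank
      (LinearMap.range (edgeBoundary (G := G)))
      (Submodule.span (ZMod 2) {(Pi.single v₀ 1 : V → ZMod 2)})
    rw [hspan, finrank_top, Module.finrank_fintype_fun_eq_card] at h1
    have h2 := finrank_span_le_card (R := ZMod 2) {(Pi.single v₀ 1 : V → ZMod 2)}
    rw [Set.toFinset_singleton, Finset.card_singleton] at h2
    omega
  have hker : Module.finrank (ZMod 2) (LinearMap.ker (faceBoundary E)) ≤ 1 := by
    have hle : LinearMap.ker (faceBoundary E) ≤
        Submodule.span (ZMod 2) {(fun _ => 1 : Quotient E.faceSetoid → ZMod 2)} := by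
      intro f hf
      rw [Submodule.mem_span_singleton]
      by_cases hd : Nonempty G.Dart
      · obtain ⟨d⟩ := hd
        refine ⟨f (E.face d), funext fun q => ?_⟩
        induction q using Quotient.ind with
        | _ d' =>
          rw [Pi.smul_apply, smul_eq_mul, mul_one]
          exact eq_of_faceBoundary_eq_zero E hG hf d d'
      · refine ⟨0, funext fun q => ?_⟩
        induction q using Quotient.ind with
        | _ d' => exact (hd ⟨d'⟩).elim
    refine (Submodule.finrank_mono hle).trans ?_
    have h2 := finrank_span_le_card (R := ZMod 2)
      {(fun _ => 1 : Quotient E.faceSetoid → ZMod 2)}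
    rwa [Set.toFinset_singleton, Finset.card_singleton] at h2
  have h1 := LinearMap.finrank_range_add_finrank_ker (edgeBoundary (G := G))
  have h2 := LinearMap.finrank_range_add_finrank_ker (faceBoundary E)
  rw [Module.finrank_fintype_fun_eq_card] at h1 h2
  have hle : LinearMap.range (faceBoundary E) ≤ LinearMap.ker (edgeBoundary (G := G)) := by
    rintro _ ⟨f, rfl⟩
    exact edgeBoundary_faceBoundary E f
  have heq := Submodule.eq_of_le_of_finrank_le hle (by omega)
  have hz' : z ∈ LinearMap.ker (edgeBoundary (G := G)) := hz
  rw [← heq] at hz'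
  exact hz'

/-- Jordan property of a spherical embedding: two walks joining the opposite corners of
a quadrilateral face cannot be disjoint. -/
lemma not_disjoint_of_quadrilateral_face [Fintype V] (E : CombEmbedding G) (hG : G.Connected)
    (hE : (Fintype.card V : ℤ) - (G.edgeSet.ncard : ℤ) + (E.numFaces : ℤ) = 2)
    {d₀ d₁ d₂ d₃ : G.Dart} (h₀ : E.facePerm d₀ = d₁) (h₁ : E.facePerm d₁ = d₂)
    (h₂ : E.facePerm d₂ = d₃) (h₃ : E.facePerm d₃ = d₀)
    (h02 : d₀.toProd.1 ≠ d₂.toProd.1) (h13 : d₁.toProd.1 ≠ d₃.toProd.1)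
    (p : G.Walk d₀.toProd.1 d₂.toProd.1) (q : G.Walk d₁.toProd.1 d₃.toProd.1) :
    ∃ x, x ∈ p.support ∧ x ∈ q.support := by
  classical
  by_contra! hdisj
  have := Fintype.ofFinite G.Dart
  have e23 : d₂.toProd.2 = d₃.toProd.1 := by rw [← h₂, E.facePerm_fst]
  have e30 : d₃.toProd.2 = d₀.toProd.1 := by rw [← h₃, E.facePerm_fst]
  obtain ⟨y, hy, hy0⟩ := exists_chain_of_walk p
  let z : G.edgeSet → ZMod 2 := y + (Pi.single (dartEdge d₂) 1 + Pi.single (dartEdge d₃) 1)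
  have hzd : ∀ e, z e = y e + ((Pi.single (dartEdge d₂) 1 : G.edgeSet → ZMod 2) e +
      (Pi.single (dartEdge d₃) 1 : G.edgeSet → ZMod 2) e) := fun _ => rfl
  have hz : edgeBoundary z = 0 := by
    rw [map_add, map_add, hy, edgeBoundary_single, edgeBoundary_single, e23, e30]
    ext v
    simp only [Pi.add_apply, Pi.zero_apply]
    generalize (Pi.single d₀.toProd.1 1 : V → ZMod 2) v = a
    generalize (Pi.single d₂.toProd.1 1 : V → ZMod 2) v = b
    generalize (Pi.single d₃.toProd.1 1 : V → ZMod 2) v = c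
    revert a b c
    decide
  obtain ⟨f, hf⟩ := exists_faceBoundary_eq E hG hE hz
  have hcross : ∀ d, f (E.face d.symm) = f (E.face d) + z (dartEdge d) := by
    intro d
    rw [← hf, faceBoundary_apply, ← add_assoc, CharTwo.add_self_eq_zero, zero_add]
  have hp0 : d₃.toProd.2 ∈ p.support := by
    rw [e30]
    exact p.start_mem_support
  have hp2 := p.end_mem_support
  have hp3 : d₃.toProd.1 ∉ p.support := fun h => hdisj _ h q.end_mem_support
  have hzero : ∀ d : G.Dart, d.toProd.1 ∉ p.support → d ≠ d₃ → d ≠ d₂.symm →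
      z (dartEdge d) = 0 := by
    intro d hd hd3 hd2
    have n2 : dartEdge d ≠ dartEdge d₂ := by
      rw [Ne, dartEdge_eq_iff]
      rintro (rfl | h)
      exacts [hd hp2, hd2 h]
    have n3 : dartEdge d ≠ dartEdge d₃ := by
      rw [Ne, dartEdge_eq_iff]
      rintro (h | rfl)
      · exact hd3 h
      · exact hd hp0
    rw [hzd, hy0 d hd, Pi.single_eq_of_ne n2, Pi.single_eq_of_ne n3, add_zero, add_zero]
  have hone : z (dartEdge d₃) = 1 := by
    have n2 : dartEdge d₃ ≠ dartEdge d₂ := by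
      rw [Ne, dartEdge_eq_iff]
      rintro (rfl | h)
      · exact hp3 hp2
      · refine h02 (e30.symm.trans ?_)
        rw [h]
        rfl
    rw [hzd, hy0 d₃ hp3, Pi.single_eq_of_ne n2, Pi.single_eq_same, zero_add, zero_add]
  have hrot : ∀ d, f (E.face (E.rot d)) = f (E.face d) + z (dartEdge d) := by
    intro d
    rw [E.face_rot, hcross]
  have hstar : ∀ d d' : G.Dart, d.toProd.1 ∉ p.support → d.toProd.1 ≠ d₃.toProd.1 →
      d.toProd.1 = d'.toProd.1 → f (E.face d') = f (E.face d) := by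
    intro d d' hd hd3 h
    obtain ⟨n, rfl⟩ := E.rot_cyclic d d' h
    clear h
    induction n with
    | zero => rfl
    | succ n ih =>
      have hfst : ((E.rot ^ n) d).toProd.1 = d.toProd.1 := by
        clear ih
        induction n with
        | zero => rfl
        | succ n ih => rw [pow_succ', Equiv.Perm.mul_apply, E.rot_fst, ih]
      rw [pow_succ', Equiv.Perm.mul_apply, hrot, ih, hzero, add_zero]
      · rwa [hfst]
      · rintro h
        rw [h] at hfst
        exact hd3 hfst.symm
      · rintro h
        rw [h] at hfst
        exact hd3 (hfst.symm.trans e23)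
  have hstar3 : ∀ d : G.Dart, d.toProd.1 = d₃.toProd.1 →
      d = d₃ ∨ f (E.face d) = f (E.face d₃) + 1 := by
    intro d h
    obtain ⟨n, rfl⟩ := E.rot_cyclic d₃ d h.symm
    clear h
    induction n with
    | zero => exact Or.inl rfl
    | succ n ih =>
      have hfst : ((E.rot ^ n) d₃).toProd.1 = d₃.toProd.1 := by
        clear ih
        induction n with
        | zero => rfl
        | succ n ih => rw [pow_succ', Equiv.Perm.mul_apply, E.rot_fst, ih]
      rw [pow_succ', Equiv.Perm.mul_apply, hrot]
      by_cases hd3 : (E.rot ^ n) d₃ = d₃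
      · rw [hd3, hone]
        exact Or.inr rfl
      by_cases hd2 : (E.rot ^ n) d₃ = d₂.symm
      · rw [hd2, ← E.facePerm_apply]
        exact Or.inl h₂
      · rw [ih.resolve_left hd3, hzero _ (by rwa [hfst]) hd3 hd2, add_zero]
        exact Or.inr rfl
  have hwalk : ∀ (u w : V) (r : G.Walk u w), (∀ x ∈ r.support, x ∉ p.support) →
      w = d₃.toProd.1 → u ≠ d₃.toProd.1 →
      ¬ ∀ d : G.Dart, d.toProd.1 = u → f (E.face d) = f (E.face d₃) := by
    intro u w r
    induction r with
    | nil => exact fun _ h h' => (h' h).elim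
    | @cons u v w huv r ih =>
      intro hr hw hu hf'
      rw [SimpleGraph.Walk.support_cons] at hr
      have hup := hr u List.mem_cons_self
      have hvp := hr v (List.mem_cons_of_mem _ r.start_mem_support)
      let a : G.Dart := ⟨(u, v), huv⟩
      have ha : f (E.face a.symm) = f (E.face d₃) := by
        rw [hcross, hf' a rfl, hzero a hup, add_zero]
        · intro h
          exact hu (congrArg (fun d : G.Dart => d.toProd.1) h)
        · intro h
          exact hu ((congrArg (fun d : G.Dart => d.toProd.1) h).trans e23)
      by_cases hv : v = d₃.toProd.1
      · rcases hstar3 a.symm hv with h | h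
        · refine hup ?_
          have : u = d₃.toProd.2 := congrArg (fun d : G.Dart => d.toProd.2) h
          rw [this]
          exact hp0
        · rw [ha] at h
          simp at h
      · refine ih (fun x hx => hr x (List.mem_cons_of_mem _ hx)) hw hv fun d hd => ?_
        rw [← ha]
        exact hstar a.symm d hvp hv hd.symm
  have hp1 : d₁.toProd.1 ∉ p.support := fun h => hdisj _ h q.start_mem_support
  refine hwalk _ _ q (fun x hx hx' => hdisj x hx' hx) rfl h13 fun d hd => ?_
  rw [hstar d₁ d hp1 h13 hd.symm, ← h₀, E.face_facePerm, ← h₃, E.face_facePerm]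

end Homology

section Kempe

variable {U : Type} {G : SimpleGraph U} {c : U → Fin 4} {a b : Fin 4} {u v w : U}

lemma KempeConnOn.color_right (h : KempeConnOn G Set.univ c a b u v) : c v = a ∨ c v = b := by
  obtain ⟨p, hp⟩ := h
  exact (hp v p.end_mem_support).2

lemma KempeConnOn.trans_adj (h : KempeConnOn G Set.univ c a b u v) (hvw : G.Adj v w)
    (hw : c w = a ∨ c w = b) : KempeConnOn G Set.univ c a b u w := by
  obtain ⟨p, hp⟩ := h
  refine ⟨p.concat hvw, fun x hx => ⟨trivial, ?_⟩⟩
  rw [SimpleGraph.Walk.support_concat, List.mem_append,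
    List.mem_singleton] at hx
  rcases hx with hx | rfl
  exacts [(hp x hx).2, hw]

lemma KempeConnOn.refl (hu : c u = a ∨ c u = b) : KempeConnOn G Set.univ c a b u u := by
  refine ⟨SimpleGraph.Walk.nil, fun x hx => ⟨trivial, ?_⟩⟩
  rw [SimpleGraph.Walk.support_nil, List.mem_singleton] at hx
  rwa [hx]

open Classical in
/-- The coloring obtained by swapping the colors `a` and `b` on the Kempe chain of `u`. -/
noncomputable def kempeSwap (G : SimpleGraph U) (c : U → Fin 4) (a b : Fin 4) (u : U) :
    U → Fin 4 :=
  fun v => if KempeConnOn G Set.univ c a b u v then Equiv.swap a b (c v) else c v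

lemma kempeSwap_of_conn (h : KempeConnOn G Set.univ c a b u v) :
    kempeSwap G c a b u v = Equiv.swap a b (c v) := if_pos h

lemma kempeSwap_of_not_conn (h : ¬ KempeConnOn G Set.univ c a b u v) :
    kempeSwap G c a b u v = c v := if_neg h

lemma kempeSwap_proper (hc : IsProperColoring G c) :
    IsProperColoring G (kempeSwap G c a b u) := by
  have key : ∀ v w, G.Adj v w → KempeConnOn G Set.univ c a b u v →
      ¬ KempeConnOn G Set.univ c a b u w →
      kempeSwap G c a b u v ≠ kempeSwap G c a b u w := by
    intro v w hvw hv hw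
    have hcw : ¬ (c w = a ∨ c w = b) := fun h => hw (hv.trans_adj hvw h)
    rw [kempeSwap_of_conn hv, kempeSwap_of_not_conn hw]
    rcases hv.color_right with h | h <;> rw [h] <;> simp <;> tauto
  intro v w hvw
  by_cases hv : KempeConnOn G Set.univ c a b u v <;>
    by_cases hw : KempeConnOn G Set.univ c a b u w
  · rw [kempeSwap_of_conn hv, kempeSwap_of_conn hw]
    exact (Equiv.swap a b).injective.ne (hc hvw)
  · exact key v w hvw hv hw
  · exact (key w v hvw.symm hw hv).symm
  · rw [kempeSwap_of_not_conn hv, kempeSwap_of_not_conn hw]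
    exact hc hvw

lemma kempeSwap_isSingleKempeChange (hab : a ≠ b) (hu : c u = a ∨ c u = b) :
    IsSingleKempeChange G c (kempeSwap G c a b u) := by
  refine ⟨a, b, hab, u, hu, fun v => ⟨fun h => ?_, fun h => kempeSwap_of_not_conn h⟩⟩
  rw [kempeSwap_of_conn h]
  rcases h.color_right with h | h <;> simp [h]

/-- Swapping the chain of `u`, when it misses `v`, changes whether `u` and `v` agree. -/
lemma kempeSwap_eq_iff_ne (hab : a ≠ b) (hu : c u = a ∨ c u = b) (hv : c v = a ∨ c v = b)
    (huv : ¬ KempeConnOn G Set.univ c a b u v) :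
    kempeSwap G c a b u u = kempeSwap G c a b u v ↔ c u ≠ c v := by
  rw [kempeSwap_of_conn (KempeConnOn.refl hu), kempeSwap_of_not_conn huv]
  rcases hu with hu | hu <;> rcases hv with hv | hv <;> rw [hu, hv] <;> simp [hab, hab.symm]

lemma kempeSwap_of_color_ne (hv : ¬ (c v = a ∨ c v = b)) : kempeSwap G c a b u v = c v :=
  kempeSwap_of_not_conn fun h => hv h.color_right

end Kempe

section Ring

/-- A coloring is determined up to a permutation of the colors by which elements receive
equal colors. -/
lemma colorPermEq_of_iff {α : Type} {κ κ' : α → Fin 4} (h : ∀ x y, κ x = κ y ↔ κ' x = κ' y) :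
    ColorPermEq κ κ' := by
  classical
  let e : Set.range κ ≃ Set.range κ' :=
    Equiv.ofBijective (fun a => ⟨κ' a.2.choose, Set.mem_range_self _⟩) <| by
      constructor
      · rintro ⟨a, ha⟩ ⟨b, hb⟩ hab
        rw [Subtype.mk.injEq, ← h, ha.choose_spec, hb.choose_spec] at hab
        exact Subtype.ext hab
      · rintro ⟨_, x, rfl⟩
        refine ⟨⟨κ x, x, rfl⟩, Subtype.ext ?_⟩
        exact (h _ _).1 (Set.mem_range_self (f := κ) x).choose_spec
  refine ⟨e.extendSubtype, fun x => ?_⟩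
  rw [e.extendSubtype_apply_of_mem _ (Set.mem_range_self x)]
  exact (h _ _).1 (Set.mem_range_self (f := κ) x).choose_spec.symm

lemma colorPermEq_of_diagonals {x y : Fin 4 → Fin 4} (hx : ∀ i, x i ≠ x (i + 1))
    (hy : ∀ i, y i ≠ y (i + 1)) (h0 : x 0 = x 2 ↔ y 0 = y 2) (h1 : x 1 = x 3 ↔ y 1 = y 3) :
    ColorPermEq x y := by
  have hx0 : x 0 ≠ x 1 := hx 0
  have hx1 : x 1 ≠ x 2 := hx 1
  have hx2 : x 2 ≠ x 3 := hx 2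
  have hx3 : x 3 ≠ x 0 := hx 3
  have hy0 : y 0 ≠ y 1 := hy 0
  have hy1 : y 1 ≠ y 2 := hy 1
  have hy2 : y 2 ≠ y 3 := hy 2
  have hy3 : y 3 ≠ y 0 := hy 3
  refine colorPermEq_of_iff fun i j => ?_
  fin_cases i <;> fin_cases j <;> simp <;> grind

/-- Two colorings of the 4-cycle differing on exactly one diagonal together realise all
colorings with one behaviour on the other diagonal. -/
lemma exists_diagonal_of_flip {x y : Fin 4 → Fin 4} (hx : ∀ i, x i ≠ x (i + 1))
    (hy : ∀ i, y i ≠ y (i + 1))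
    (h : ((y 0 = y 2 ↔ x 0 ≠ x 2) ∧ (y 1 = y 3 ↔ x 1 = x 3)) ∨
      ((y 1 = y 3 ↔ x 1 ≠ x 3) ∧ (y 0 = y 2 ↔ x 0 = x 2))) :
    ∃ j : Fin 4, (j = 0 ∨ j = 1) ∧
      ((∀ κ : Fin 4 → Fin 4, (∀ i : Fin 4, κ i ≠ κ (i + 1)) → κ j ≠ κ (j + 2) →
          (ColorPermEq κ x ∨ ColorPermEq κ y)) ∨
       (∀ κ : Fin 4 → Fin 4, (∀ i : Fin 4, κ i ≠ κ (i + 1)) → κ j = κ (j + 2) →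
          (ColorPermEq κ x ∨ ColorPermEq κ y))) := by
  have key : ∀ κ : Fin 4 → Fin 4, (∀ i : Fin 4, κ i ≠ κ (i + 1)) →
      ((κ 0 = κ 2 ↔ x 0 = x 2) ∧ (κ 1 = κ 3 ↔ x 1 = x 3)) ∨
      ((κ 0 = κ 2 ↔ y 0 = y 2) ∧ (κ 1 = κ 3 ↔ y 1 = y 3)) →
      ColorPermEq κ x ∨ ColorPermEq κ y := fun κ hκ h =>
    h.imp (fun h => colorPermEq_of_diagonals hκ hx h.1 h.2)
      (fun h => colorPermEq_of_diagonals hκ hy h.1 h.2)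
  rcases h with ⟨h, h'⟩ | ⟨h, h'⟩
  · refine ⟨1, Or.inr rfl, ?_⟩
    by_cases hs : x 1 = x 3
    · refine Or.inr fun κ hκ hd => key κ hκ ?_
      have hd : κ 1 = κ 3 := hd
      tauto
    · refine Or.inl fun κ hκ hd => key κ hκ ?_
      have hd : κ 1 ≠ κ 3 := hd
      tauto
  · refine ⟨0, Or.inl rfl, ?_⟩
    by_cases hs : x 0 = x 2
    · refine Or.inr fun κ hκ hd => key κ hκ ?_
      have hd : κ 0 = κ 2 := hd
      tauto
    · refine Or.inl fun κ hκ hd => key κ hκ ?_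
      have hd : κ 0 ≠ κ 2 := hd
      tauto

/-- The colors on the two diagonals of a properly colored 4-cycle lie in complementary pairs. -/
lemma exists_complementary_pairs (x₀ x₁ x₂ x₃ : Fin 4) (h01 : x₀ ≠ x₁) (h12 : x₁ ≠ x₂)
    (h23 : x₂ ≠ x₃) (h30 : x₃ ≠ x₀) :
    ∃ a b e f : Fin 4, a ≠ b ∧ e ≠ f ∧ a ≠ e ∧ a ≠ f ∧ b ≠ e ∧ b ≠ f ∧
      (x₀ = a ∨ x₀ = b) ∧ (x₂ = a ∨ x₂ = b) ∧ (x₁ = e ∨ x₁ = f) ∧ (x₃ = e ∨ x₃ = f) := by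
  revert x₀ x₁ x₂ x₃
  decide

lemma fin_four_cases : ∀ i j k : Fin 4, 0 ≠ i → 0 ≠ j → 0 ≠ k → i ≠ j → i ≠ k → j ≠ k →
    (i = 1 ∧ j = 2 ∧ k = 3) ∨ (i = 3 ∧ j = 2 ∧ k = 1) ∨
    (i = 2 ∧ j = 1 ∧ k = 3) ∨ (i = 3 ∧ j = 1 ∧ k = 2) ∨
    (i = 1 ∧ j = 3 ∧ k = 2) ∨ (i = 2 ∧ j = 3 ∧ k = 1) := by
  intro i j k
  fin_cases i <;> fin_cases j <;> fin_cases k <;> simp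

variable {V : Type} [Fintype V]

/-- Walks joining the opposite corners of the outer 4-cycle of a near-triangulation meet.
The outer face might a priori visit the ring in another order, but then two opposite edges of
the ring would be crossing chords. -/
lemma NearTriangulation.not_disjoint_of_ring (N : NearTriangulation V) (rv : Fin 4 → V)
    (hrv : Function.Injective rv)
    (hadj : ∀ i : Fin 4, N.graph.Adj (rv i) (rv (i + 1)))
    (hout : ∀ x : V, N.OnOuter x ↔ ∃ i : Fin 4, rv i = x)
    (hsimple : ∀ d d' : N.graph.Dart, N.isOuter d → N.isOuter d' →
      d.toProd.1 = d'.toProd.1 → d = d')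
    (p : N.graph.Walk (rv 0) (rv 2)) (q : N.graph.Walk (rv 1) (rv 3)) :
    ∃ x, x ∈ p.support ∧ x ∈ q.support := by
  classical
  have hE : (Fintype.card V : ℤ) - (N.graph.edgeSet.ncard : ℤ) + (N.emb.numFaces : ℤ) = 2 := by
    refine N.euler.resolve_left fun h => ?_
    have := Fintype.card_le_of_injective rv hrv
    rw [Fintype.card_fin] at this
    omega
  have hex : ∀ i, ∃ d : N.graph.Dart, N.isOuter d ∧ d.toProd.1 = rv i := fun i =>
    ((hout (rv i)).2 ⟨i, rfl⟩).resolve_left fun h => h.false ⟨(rv 0, rv (0 + 1)), hadj 0⟩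
  choose D hD hDfst using hex
  have hDinj : Function.Injective D := fun i j h => hrv (by rw [← hDfst, ← hDfst, h])
  have hDmem : ∀ d, N.isOuter d → ∃ i, D i = d := by
    intro d hd
    obtain ⟨i, hi⟩ := (hout d.toProd.1).1 (Or.inr ⟨d, hd, rfl⟩)
    exact ⟨i, hsimple _ _ (hD i) hd ((hDfst i).trans hi)⟩
  let S : Finset N.graph.Dart := Finset.univ.image D
  have hS : ∀ d, d ∈ S ↔ N.isOuter d := by
    intro d
    simp only [S, Finset.mem_image, Finset.mem_univ, true_and]
    exact ⟨fun ⟨i, hi⟩ => hi ▸ hD i, hDmem d⟩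
  have hcard : S.card = 4 := by
    rw [Finset.card_image_of_injective _ hDinj, Finset.card_univ, Fintype.card_fin]
  have hcyc : N.emb.facePerm.IsCycleOn S := by
    refine ⟨⟨fun d hd => ?_, N.emb.facePerm.injective.injOn, fun d hd => ?_⟩,
      fun d hd d' hd' => ?_⟩
    · exact (hS _).2 (N.outer_closed d ((hS d).1 hd))
    · have hd := (hS d).1 hd
      obtain ⟨n, hn⟩ := N.outer_single _ d (N.outer_closed d hd) hd
      have hmem : ∀ m : ℕ, N.isOuter ((N.emb.facePerm ^ m) d) := by
        intro m
        induction m with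
        | zero => exact hd
        | succ m ih =>
          rw [pow_succ', Equiv.Perm.mul_apply]
          exact N.outer_closed _ ih
      refine ⟨(N.emb.facePerm ^ n) d, (hS _).2 (hmem n), ?_⟩
      rw [← Equiv.Perm.mul_apply, ← pow_succ', pow_succ, Equiv.Perm.mul_apply, hn]
    · obtain ⟨n, hn⟩ := N.outer_single d d' ((hS d).1 hd) ((hS d').1 hd')
      exact ⟨n, by rw [zpow_natCast, hn]⟩
  have hmem0 : D 0 ∈ S := (hS _).2 (hD 0)
  have hpow : ∀ m n : ℕ, m < 4 → n < 4 → (N.emb.facePerm ^ m) (D 0) =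
      (N.emb.facePerm ^ n) (D 0) → m = n := by
    intro m n hm hn h
    have := (hcyc.pow_apply_eq_pow_apply hmem0).1 h
    rw [hcard] at this
    unfold Nat.ModEq at this
    omega
  have hclose : (N.emb.facePerm ^ 4) (D 0) = D 0 := by
    have := hcyc.pow_card_apply hmem0
    rwa [hcard] at this
  have o1 := N.outer_closed _ (hD 0)
  have o2 := N.outer_closed _ o1
  have o3 := N.outer_closed _ o2
  obtain ⟨i, hi⟩ := hDmem _ o1
  obtain ⟨j, hj⟩ := hDmem _ o2
  obtain ⟨k, hk⟩ := hDmem _ o3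
  have e1 : N.emb.facePerm (D 0) = D i := hi.symm
  have e2 : N.emb.facePerm (D i) = D j := by rw [hi, hj]
  have e3 : N.emb.facePerm (D j) = D k := by rw [hj, hk]
  have e4 : N.emb.facePerm (D k) = D 0 := by rw [hk]; exact hclose
  have f1 : (N.emb.facePerm ^ 1) (D 0) = D i := hi.symm
  have f2 : (N.emb.facePerm ^ 2) (D 0) = D j := hj.symm
  have f3 : (N.emb.facePerm ^ 3) (D 0) = D k := hk.symm
  have n0i : 0 ≠ i := by
    rintro rfl
    exact absurd (hpow 0 1 (by decide) (by decide) f1.symm) (by decide)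
  have n0j : 0 ≠ j := by
    rintro rfl
    exact absurd (hpow 0 2 (by decide) (by decide) f2.symm) (by decide)
  have n0k : 0 ≠ k := by
    rintro rfl
    exact absurd (hpow 0 3 (by decide) (by decide) f3.symm) (by decide)
  have nij : i ≠ j := by
    rintro rfl
    exact absurd (hpow 1 2 (by decide) (by decide) (f1.trans f2.symm)) (by decide)
  have nik : i ≠ k := by
    rintro rfl
    exact absurd (hpow 1 3 (by decide) (by decide) (f1.trans f3.symm)) (by decide)
  have njk : j ≠ k := by
    rintro rfl
    exact absurd (hpow 2 3 (by decide) (by decide) (f2.trans f3.symm)) (by decide)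
  have hquad : ∀ (p : N.graph.Walk (rv 0) (rv j)) (q : N.graph.Walk (rv i) (rv k)),
      ∃ x, x ∈ p.support ∧ x ∈ q.support := by
    intro p q
    have := not_disjoint_of_quadrilateral_face N.emb N.conn hE e1 e2 e3 e4
      (by rw [hDfst, hDfst]; exact hrv.ne n0j) (by rw [hDfst, hDfst]; exact hrv.ne nik)
      (p.copy (hDfst 0).symm (hDfst j).symm) (q.copy (hDfst i).symm (hDfst k).symm)
    simpa only [SimpleGraph.Walk.support_copy] using this
  have hchord : N.graph.Adj (rv 0) (rv j) → ¬ N.graph.Adj (rv i) (rv k) := by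
    intro h h'
    obtain ⟨x, hx, hx'⟩ := hquad h.toWalk h'.toWalk
    simp only [SimpleGraph.Adj.toWalk, SimpleGraph.Walk.support_cons,
      SimpleGraph.Walk.support_nil, List.mem_cons, List.not_mem_nil, or_false] at hx hx'
    rcases hx with rfl | rfl <;> rcases hx' with h | h
    exacts [n0i (hrv h), n0k (hrv h), nij (hrv h).symm, njk (hrv h)]
  have hcases : (i = 1 ∧ j = 2 ∧ k = 3) ∨ (i = 3 ∧ j = 2 ∧ k = 1) ∨
      (i = 2 ∧ j = 1 ∧ k = 3) ∨ (i = 3 ∧ j = 1 ∧ k = 2) ∨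
      (i = 1 ∧ j = 3 ∧ k = 2) ∨ (i = 2 ∧ j = 3 ∧ k = 1) :=
    fin_four_cases i j k n0i n0j n0k nij nik njk
  rcases hcases with ⟨rfl, rfl, rfl⟩ | ⟨rfl, rfl, rfl⟩ | ⟨rfl, rfl, rfl⟩ | ⟨rfl, rfl, rfl⟩ |
    ⟨rfl, rfl, rfl⟩ | ⟨rfl, rfl, rfl⟩
  · exact hquad p q
  · simpa using hquad p q.reverse
  · exact (hchord (hadj 0) (hadj 2)).elim
  · exact (hchord (hadj 0) (hadj 2).symm).elim
  · exact (hchord (hadj 3).symm (hadj 1)).elim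
  · exact (hchord (hadj 3).symm (hadj 1).symm).elim

end Ring

end FourColor

open FourColor in
/-- Let `H` be a near-triangulation whose outer face is
bounded by the 4-cycle `R = v₀v₁v₂v₃` (0-indexed), with a proper 4-coloring.
By a single Kempe change (in time linear in `|H|`, modelled by the step
count), one can produce a second proper coloring `c'` and `j ∈ {0,1}` such
that the two colorings restrict to `R` as (i) both 4-colorings of `R`, up to
permutation of colors, in which `v_j` and `v_{j+2}` receive different colors,
or (ii) both 4-colorings of `R` in which `v_j` and `v_{j+2}` receive the same
color. -/
theorem kempe_change_four_ring :
    ∃ K : ℕ,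
      ∀ (V : Type) [Fintype V] (N : NearTriangulation V) (rv : Fin 4 → V),
        Function.Injective rv →
        (∀ i : Fin 4, N.graph.Adj (rv i) (rv (i + 1))) →
        (∀ x : V, N.OnOuter x ↔ ∃ i : Fin 4, rv i = x) →
        (∀ d d' : N.graph.Dart, N.isOuter d → N.isOuter d' →
          d.toProd.1 = d'.toProd.1 → d = d') →
        ∀ c : V → Fin 4, IsProperColoring N.graph c →
        ∃ (c' : V → Fin 4) (j : Fin 4) (steps : ℕ),
          steps ≤ K * Fintype.card V ∧
          IsProperColoring N.graph c' ∧
          IsSingleKempeChange N.graph c c' ∧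
          (j = 0 ∨ j = 1) ∧
          ((∀ κ : Fin 4 → Fin 4, (∀ i : Fin 4, κ i ≠ κ (i + 1)) →
              κ j ≠ κ (j + 2) →
              (ColorPermEq κ (fun i => c (rv i)) ∨
               ColorPermEq κ (fun i => c' (rv i)))) ∨
           (∀ κ : Fin 4 → Fin 4, (∀ i : Fin 4, κ i ≠ κ (i + 1)) →
              κ j = κ (j + 2) →
              (ColorPermEq κ (fun i => c (rv i)) ∨
               ColorPermEq κ (fun i => c' (rv i))))) := by
  refine ⟨0, fun V _ N rv hrv hadj hout hsimple c hc => ?_⟩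
  have hcrv : ∀ i, c (rv i) ≠ c (rv (i + 1)) := fun i => hc (hadj i)
  obtain ⟨a, b, e, f, hab, hef, hae, haf, hbe, hbf, h0, h2, h1, h3⟩ :=
    exists_complementary_pairs (c (rv 0)) (c (rv 1)) (c (rv 2)) (c (rv 3))
      (hcrv 0) (hcrv 1) (hcrv 2) (hcrv 3)
  have hdisj : ∀ x, (c x = a ∨ c x = b) → ¬ (c x = e ∨ c x = f) := by
    rintro x (h | h) <;> rw [h] <;> tauto
  have hchain : ¬ KempeConnOn N.graph Set.univ c a b (rv 0) (rv 2) ∨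
      ¬ KempeConnOn N.graph Set.univ c e f (rv 1) (rv 3) := by
    by_contra! h
    obtain ⟨⟨p, hp⟩, q, hq⟩ := h
    obtain ⟨x, hxp, hxq⟩ := N.not_disjoint_of_ring rv hrv hadj hout hsimple p q
    exact hdisj x (hp x hxp).2 (hq x hxq).2
  have hdisj' : ∀ x, (c x = e ∨ c x = f) → ¬ (c x = a ∨ c x = b) :=
    fun x h h' => hdisj x h' h
  rcases hchain with h | h
  · have hproper : IsProperColoring N.graph (kempeSwap N.graph c a b (rv 0)) :=
      kempeSwap_proper hc
    obtain ⟨j, hj, hκ⟩ := exists_diagonal_of_flip (x := fun i => c (rv i))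
      (y := fun i => kempeSwap N.graph c a b (rv 0) (rv i)) hcrv
      (fun i => hproper (hadj i))
      (Or.inl ⟨kempeSwap_eq_iff_ne hab h0 h2 h, by
        simp only [kempeSwap_of_color_ne (hdisj' _ h1), kempeSwap_of_color_ne (hdisj' _ h3)]⟩)
    exact ⟨_, j, 0, Nat.zero_le _, hproper, kempeSwap_isSingleKempeChange hab h0, hj, hκ⟩
  · have hproper : IsProperColoring N.graph (kempeSwap N.graph c e f (rv 1)) :=
      kempeSwap_proper hc
    obtain ⟨j, hj, hκ⟩ := exists_diagonal_of_flip (x := fun i => c (rv i))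
      (y := fun i => kempeSwap N.graph c e f (rv 1) (rv i)) hcrv
      (fun i => hproper (hadj i))
      (Or.inr ⟨kempeSwap_eq_iff_ne hef h1 h3 h, by
        simp only [kempeSwap_of_color_ne (hdisj _ h0), kempeSwap_of_color_ne (hdisj _ h2)]⟩)
    exact ⟨_, j, 0, Nat.zero_le _, hproper, kempeSwap_isSingleKempeChange hef h1, hj, hκ⟩
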